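/- There is no divisible design Cayley graph with parameters (27, 8, 4, 2, 9, 3); that is, no simple graph on 27 vertices that is simultaneously a divisible design graph with parameters (27, 8, 4, 2, 9, 3) and a Cayley graph. -/

import Mathlib

/-- A divisible design graph (DDG) with parameters `(v, k, l1, l2, m, n)`:
a `k`-regular simple graph on `v = m * n` vertices whose vertex set can be partitioned
into `m` classes of size `n` such that two distinct vertices from the same class have
exactly `l1` common neighbours and two vertices from different classes have exactly `l2`
common neighbours. -/
def IsDDG {V : Type*} (Γ : SimpleGraph V) (v k l1 l2 m n : ℕ) : Prop :=
  Nat.card V = v ∧ v = m * n ∧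
  (∀ x : V, Nat.card {z : V // Γ.Adj x z} = k) ∧
  ∃ c : V → Fin m,
    (∀ i : Fin m, Nat.card {x : V // c x = i} = n) ∧
    (∀ x y : V, x ≠ y → c x = c y →
      Nat.card {z : V // Γ.Adj x z ∧ Γ.Adj y z} = l1) ∧
    (∀ x y : V, c x ≠ c y →
      Nat.card {z : V // Γ.Adj x z ∧ Γ.Adj y z} = l2)

/-- A simple graph is a Cayley graph if and only if its automorphism group contains a
subgroup acting regularly (sharply transitively) on the vertices. -/
def IsCayleyGraph {V : Type*} (Γ : SimpleGraph V) : Prop :=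
  ∃ H : Subgroup (Equiv.Perm V),
    (∀ g ∈ H, ∀ x y : V, Γ.Adj (g x) (g y) ↔ Γ.Adj x y) ∧
    ∀ x y : V, ∃! g : Equiv.Perm V, g ∈ H ∧ g x = y

/-- A finite group whose order is `p ^ (n + 1)` admits, above every `p`-subgroup of order
`p ^ k` with `k ≤ n`, a surjection onto the cyclic group of order `p` killing that subgroup. -/
theorem exists_hom_zmod_of_card_eq_prime_pow {G : Type*} [Group G] [Finite G] {p n k : ℕ}
    [hp : Fact p.Prime] (hG : Nat.card G = p ^ (n + 1)) (N : Subgroup G)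
    (hN : Nat.card N = p ^ k) (hk : k ≤ n) :
    ∃ f : G →* Multiplicative (ZMod p), N ≤ f.ker ∧ Nat.card f.ker = p ^ n := by
  obtain ⟨M, hM, hNM⟩ := Sylow.exists_subgroup_card_pow_prime_le p
    (hG ▸ pow_dvd_pow p n.le_succ) N hN hk
  have hindex : M.index = p := by
    have h := M.card_mul_index
    rw [hM, hG, pow_succ] at h
    exact Nat.eq_of_mul_eq_mul_left (pow_pos hp.out.pos n) h
  have : M.Normal := Subgroup.normal_of_index_eq_minFac_card
    (by rw [hindex, hG, hp.out.pow_minFac n.succ_ne_zero])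
  have hquot : Nat.card (G ⧸ M) = p := hindex
  let e : G ⧸ M ≃* Multiplicative (ZMod p) := mulEquivOfPrimeCardEq hquot (by simp)
  have hker : (e.toMonoidHom.comp (QuotientGroup.mk' M)).ker = M := by
    ext g
    simp
  exact ⟨e.toMonoidHom.comp (QuotientGroup.mk' M), hker.symm ▸ hNM, hker.symm ▸ hM⟩

/-- In terms of the connection set: a group of order 27 has no symmetric 8-subset `S` such that
the number of ways of writing `m` as `g * h⁻¹` with `g, h ∈ S` is `4` for `1 ≠ m ∈ N` and `2`
for `m ∉ N`, where `N` is a subgroup of order 3. -/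
theorem not_exists_connection_set {G : Type*} [Group G] [Fintype G] [DecidableEq G]
    (hG : Nat.card G = 27) (N : Subgroup G) (hN : Nat.card N = 3) (S : Finset G)
    (hinv : ∀ g, g⁻¹ ∈ S ↔ g ∈ S) (hS : S.card = 8)
    (h4 : ∀ m ∈ N, m ≠ 1 → (S.filter fun g => m⁻¹ * g ∈ S).card = 4)
    (h2 : ∀ m ∉ N, (S.filter fun g => m⁻¹ * g ∈ S).card = 2) : False := by
  classical
  have : Fact (Nat.Prime 3) := ⟨Nat.prime_three⟩
  obtain ⟨f, hNf, hf⟩ := exists_hom_zmod_of_card_eq_prime_pow (p := 3) (n := 2) (k := 1)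
    hG N hN one_le_two
  let φ : G → ZMod 3 := fun g => (f g).toAdd
  let a : ZMod 3 → ℕ := fun i => (S.filter fun g => φ g = i).card
  have ha_symm : a 1 = a 2 := by
    refine Finset.card_bij (fun g _ => g⁻¹) (fun g hg => ?_) (fun g _ h _ => inv_injective.eq_iff.1)
      (fun g hg => ⟨g⁻¹, ?_, inv_inv g⟩) <;>
    · simp only [Finset.mem_filter, hinv, φ, map_inv, toAdd_inv] at hg ⊢
      rw [hg.2]
      exact ⟨hg.1, rfl⟩
  have ha_sum : a 0 + a 1 + a 2 = 8 := by
    rw [← hS, Finset.card_eq_sum_card_fiberwise (f := φ) (t := Finset.univ)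
      fun _ _ => Finset.mem_coe.2 (Finset.mem_univ _)]
    exact (Fin.sum_univ_three a).symm
  let M : Finset G := Finset.univ.filter fun g => g ∈ f.ker
  let N' : Finset G := Finset.univ.filter fun g => g ∈ N
  have hM : M.card = 9 := by
    rw [← Fintype.card_subtype, ← Nat.card_eq_fintype_card]
    exact hf
  have hN' : N'.card = 3 := by
    rw [← Fintype.card_subtype, ← Nat.card_eq_fintype_card]
    exact hN
  have hN'M : N' ⊆ M := fun g hg => by
    simp only [N', M, Finset.mem_filter, Finset.mem_univ, true_and] at hg ⊢
    exact hNf hg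
  have hone : 1 ∈ N' := by simp [N', N.one_mem]
  have hcount : ∑ m ∈ M, (S.filter fun g => m⁻¹ * g ∈ S).card = 28 := by
    rw [← Finset.sum_sdiff hN'M, ← Finset.add_sum_erase _ _ hone,
      Finset.sum_congr rfl (g := fun _ => 2), Finset.sum_congr (s₁ := N'.erase 1) rfl
        (g := fun _ => 4), Finset.sum_const, Finset.sum_const, Finset.card_sdiff_of_subset hN'M,
      Finset.card_erase_of_mem hone, hM, hN']
    · simp [hS]
    · intro m hm
      simp only [N', Finset.mem_erase, Finset.mem_filter, Finset.mem_univ, true_and] at hm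
      exact h4 m hm.2 hm.1
    · intro m hm
      simp only [N', Finset.mem_sdiff, Finset.mem_filter, Finset.mem_univ, true_and] at hm
      exact h2 m hm.2
  have hfiber : ∀ g ∈ S, (M.filter fun m => m⁻¹ * g ∈ S).card = a (φ g) := by
    intro g _
    refine Finset.card_bij (fun m _ => m⁻¹ * g) (fun m hm => ?_) (fun m _ m' _ h => by simpa using h)
      (fun h hh => ⟨g * h⁻¹, ?_, by group⟩)
    · simp only [M, Finset.mem_filter, Finset.mem_univ, true_and, MonoidHom.mem_ker] at hm
      simp [φ, hm.1, hm.2]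
    · simp only [φ, Finset.mem_filter, EmbeddingLike.apply_eq_iff_eq] at hh
      simp [M, MonoidHom.mem_ker, hh.1, hh.2]
  have hsquares : ∑ m ∈ M, (S.filter fun g => m⁻¹ * g ∈ S).card = a 0 ^ 2 + a 1 ^ 2 + a 2 ^ 2 := by
    have hswap := Finset.sum_card_bipartiteAbove_eq_sum_card_bipartiteBelow
      (s := M) (t := S) fun m g => m⁻¹ * g ∈ S
    simp only [Finset.bipartiteAbove, Finset.bipartiteBelow] at hswap
    rw [hswap, Finset.sum_congr rfl hfiber, ← Finset.sum_fiberwise' S φ a]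
    simp only [Finset.sum_const, smul_eq_mul, sq]
    exact Fin.sum_univ_three fun i => a i * a i
  rw [hcount, ← ha_symm] at hsquares
  rw [← ha_symm] at ha_sum
  have hle : a 1 ≤ 4 := by omega
  have h0 : a 0 = 8 - 2 * a 1 := by omega
  rw [h0] at hsquares
  interval_cases a 1 <;> omega

/-- There is no divisible design Cayley graph with parameters
`(27, 8, 4, 2, 9, 3)`. -/
theorem no_ddcg_27_8_4_2_9_3 :
    ¬ ∃ (V : Type) (Γ : SimpleGraph V),
        IsDDG Γ 27 8 4 2 9 3 ∧ IsCayleyGraph Γ := by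
  classical
  rintro ⟨V, Γ, ⟨hV, -, hdeg, c, hc, hsame, hdiff⟩, H, haut, hreg⟩
  have : Finite V := Nat.finite_of_card_ne_zero (by omega)
  have : Fintype H := Fintype.ofFinite H
  have hne : Nonempty V := (Nat.card_pos_iff.1 (by omega)).1
  obtain ⟨o⟩ := hne
  let e : H ≃ V := Equiv.ofBijective (fun g => g.1 o) ⟨fun g h hgh =>
    Subtype.ext ((hreg o (h.1 o)).unique ⟨g.2, hgh⟩ ⟨h.2, rfl⟩), fun x =>
      let ⟨g, hg, _⟩ := hreg o x
      ⟨⟨g, hg.1⟩, hg.2⟩⟩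
  have hcommon : ∀ g ∈ H, ∀ x y, Nat.card {z // Γ.Adj (g x) z ∧ Γ.Adj (g y) z} =
      Nat.card {z // Γ.Adj x z ∧ Γ.Adj y z} := fun g hg x y =>
    (Nat.card_congr (g.subtypeEquiv fun z => by rw [haut g hg, haut g hg])).symm
  have hclass : ∀ g ∈ H, ∀ x y, c x = c y → c (g x) = c (g y) := by
    intro g hg x y hxy
    by_contra hne
    have hxy' : x ≠ y := by
      rintro rfl
      exact hne rfl
    have h := hcommon g hg x y
    rw [hsame x y hxy' hxy, hdiff _ _ hne] at h
    omega
  let N : Subgroup H :=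
    { carrier := {g | c (g.1 o) = c o}
      one_mem' := rfl
      mul_mem' := fun {g h} hg hh => (hclass g.1 g.2 _ _ hh).trans hg
      inv_mem' := fun {g} hg => by
        have h := hclass _ (g⁻¹).2 _ _ hg
        simpa using h.symm }
  let S : Finset H := Finset.univ.filter fun g => Γ.Adj o (g.1 o)
  have hadj : ∀ m g : H, Γ.Adj (m.1 o) (g.1 o) ↔ m⁻¹ * g ∈ S := by
    intro m g
    rw [← haut _ (m⁻¹).2]
    simp [S]
  have hS : ∀ g, g ∈ S ↔ Γ.Adj o (g.1 o) := by simp [S]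
  have hcard : ∀ m : H, (S.filter fun g => m⁻¹ * g ∈ S).card =
      Nat.card {z // Γ.Adj o z ∧ Γ.Adj (m.1 o) z} := by
    intro m
    rw [← Nat.card_congr (e.subtypeEquiv (p := fun g => g ∈ S.filter fun g => m⁻¹ * g ∈ S)
      fun g => by rw [Finset.mem_filter, hS, ← hadj]; rfl)]
    exact (Nat.card_eq_finsetCard _).symm
  refine not_exists_connection_set ((Nat.card_congr e).trans hV) N ?_ S (fun g => ?_) ?_
    (fun m hm hm1 => ?_) (fun m hm => ?_)
  · rw [← hc (c o)]
    exact Nat.card_congr (e.subtypeEquiv fun g => Iff.rfl)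
  · have h := hadj g 1
    rw [mul_one] at h
    rw [← h, hS, Γ.adj_comm]
    rfl
  · rw [← hdeg o, ← Nat.card_congr (e.subtypeEquiv (p := fun g => g ∈ S) fun g => hS g)]
    simp
  · rw [hcard]
    exact hsame _ _ (fun h => hm1 (e.injective h.symm)) (Eq.symm hm)
  · rw [hcard]
    exact hdiff _ _ (Ne.symm hm)
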